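/- arXiv:2512.05319 — 2 statements merged into one kernel-verified Lean document; each statement's English description precedes it below -/
import Mathlib

section
/- Let (Γ,s) be a finite signed graph without isolated vertices, with signed Cheeger constant h₁^s and signed normalized Laplacian eigenvalues λ₁ ≤ ⋯ ≤ λ_N. Then 1 − √(1 − (h₁^s)²) ≤ λ₁ ≤ 2h₁^s. -/
open scoped BigOperators

/-- The signed normalized Laplacian of a signed graph `(Γ,s)`:
`Δ_s f(v) = f(v) − (1/deg v) Σ_{u∼v} s(vu) f(u)`. -/
noncomputable def slap {V : Type*} [Fintype V] (G : SimpleGraph V) [DecidableRel G.Adj]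
    (s : V → V → ℝ) (f : V → ℝ) : V → ℝ :=
  fun v => f v - (∑ u ∈ G.neighborFinset v, s v u * f u) / (G.degree v : ℝ)

/-- The signed bipartiteness ratio `β^s(V₁,V₂)` of a pair of disjoint vertex sets:
`[2(|E⁻(V₁)| + |E⁻(V₂)| + |E⁺(V₁,V₂)|) + |∂(V₁⊔V₂)|] / vol(V₁⊔V₂)`.
(Sums over ordered pairs count each edge inside a set twice.) -/
noncomputable def signedBeta {V : Type*} [Fintype V] [DecidableEq V] (G : SimpleGraph V)
    [DecidableRel G.Adj] (s : V → V → ℝ) (A B : Finset V) : ℝ :=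
  ((∑ u ∈ A, ∑ v ∈ A, if G.Adj u v ∧ s u v = -1 then (1 : ℝ) else 0) +
    (∑ u ∈ B, ∑ v ∈ B, if G.Adj u v ∧ s u v = -1 then (1 : ℝ) else 0) +
    2 * (∑ u ∈ A, ∑ v ∈ B, if G.Adj u v ∧ s u v = 1 then (1 : ℝ) else 0) +
    (∑ u ∈ A ∪ B, ∑ v ∈ (A ∪ B)ᶜ, if G.Adj u v then (1 : ℝ) else 0)) /
    ∑ v ∈ A ∪ B, (G.degree v : ℝ)

/-- The signed Cheeger constant `h₁^s`: the minimum of `β^s(V₁,V₂)` over all pairs of disjoint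
subsets `(V₁,V₂) ≠ (∅,∅)`. -/
noncomputable def signedCheeger {V : Type*} [Fintype V] [DecidableEq V] (G : SimpleGraph V)
    [DecidableRel G.Adj] (s : V → V → ℝ) : ℝ :=
  sInf { r : ℝ | ∃ A B : Finset V, Disjoint A B ∧ (A ∪ B).Nonempty ∧
    r = signedBeta G s A B }

/-- The ordered pairs of adjacent vertices. -/
def adjPairs {V : Type*} [Fintype V] (G : SimpleGraph V) [DecidableRel G.Adj] : Finset (V × V) :=
  Finset.univ.filter fun p => G.Adj p.1 p.2

/-- The function equal to `1` on `A`, to `-1` on `B` and to `0` elsewhere (for disjoint `A`, `B`). -/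
def signInd {V : Type*} [DecidableEq V] (A B : Finset V) (v : V) : ℝ :=
  (if v ∈ A then 1 else 0) - (if v ∈ B then 1 else 0)

section Pairs

variable {V : Type*} [Fintype V] (G : SimpleGraph V) [DecidableRel G.Adj]

theorem sum_adjPairs (F : V → V → ℝ) :
    ∑ p ∈ adjPairs G, F p.1 p.2 = ∑ u, ∑ v, if G.Adj u v then F u v else 0 := by
  rw [adjPairs, Finset.sum_filter, Fintype.sum_prod_type]

theorem sum_adjPairs_fst (g : V → ℝ) :
    ∑ p ∈ adjPairs G, g p.1 = ∑ v, (G.degree v : ℝ) * g v := by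
  rw [sum_adjPairs G fun u _ => g u]
  refine Finset.sum_congr rfl fun u _ => ?_
  rw [← Finset.sum_filter, Finset.sum_const, nsmul_eq_mul, ← G.card_neighborFinset_eq_degree,
    G.neighborFinset_eq_filter]

theorem sum_adjPairs_snd (g : V → ℝ) :
    ∑ p ∈ adjPairs G, g p.2 = ∑ v, (G.degree v : ℝ) * g v := by
  rw [← sum_adjPairs_fst G g, sum_adjPairs G fun _ v => g v, sum_adjPairs G fun u _ => g u,
    Finset.sum_comm]
  simp only [G.adj_comm]

theorem sum_degree_mul_slap (hiso : ∀ v, 0 < G.degree v) (s : V → V → ℝ) (g f : V → ℝ) :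
    ∑ v, (G.degree v : ℝ) * g v * slap G s f v =
      ∑ v, (G.degree v : ℝ) * g v * f v - ∑ p ∈ adjPairs G, g p.1 * (s p.1 p.2 * f p.2) := by
  rw [sum_adjPairs G fun u v => g u * (s u v * f v), ← Finset.sum_sub_distrib]
  refine Finset.sum_congr rfl fun v _ => ?_
  have hd : (G.degree v : ℝ) ≠ 0 := by exact_mod_cast (hiso v).ne'
  rw [slap, ← Finset.sum_filter, ← G.neighborFinset_eq_filter, ← Finset.mul_sum]
  field_simp

theorem sum_degree_pos (hiso : ∀ v, 0 < G.degree v) {A : Finset V} (hA : A.Nonempty) :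
    0 < ∑ v ∈ A, (G.degree v : ℝ) :=
  Finset.sum_pos (fun v _ => by exact_mod_cast hiso v) hA

end Pairs

section Beta

variable {V : Type*} [Fintype V] [DecidableEq V] (G : SimpleGraph V) [DecidableRel G.Adj]
  (s : V → V → ℝ)

/-- The numerator of `signedBeta` is the volume of `A ∪ B` minus the number of ordered pairs of
adjacent vertices on which `signInd A B` agrees with the signature. -/
theorem signedBeta_mul_vol (hiso : ∀ v, 0 < G.degree v)
    (hs : ∀ u v, G.Adj u v → s u v = 1 ∨ s u v = -1) (hss : ∀ u v, s u v = s v u)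
    {A B : Finset V} (hAB : Disjoint A B) (hne : (A ∪ B).Nonempty) :
    signedBeta G s A B * ∑ v ∈ A ∪ B, (G.degree v : ℝ) =
      ∑ v ∈ A ∪ B, (G.degree v : ℝ) - ∑ p ∈ adjPairs G,
        if signInd A B p.1 * (s p.1 p.2 * signInd A B p.2) = 1 then (1 : ℝ) else 0 := by
  rw [signedBeta, div_mul_cancel₀ _ (sum_degree_pos G hiso hne).ne']
  have hcross : (∑ u ∈ A, ∑ v ∈ B, if G.Adj u v ∧ s u v = 1 then (1 : ℝ) else 0) =
      ∑ u ∈ B, ∑ v ∈ A, if G.Adj u v ∧ s u v = 1 then (1 : ℝ) else 0 := by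
    rw [Finset.sum_comm]
    refine Finset.sum_congr rfl fun u _ => Finset.sum_congr rfl fun v _ => ?_
    simp only [hss v u, G.adj_comm v u]
  have hvol : ∑ v ∈ A ∪ B, (G.degree v : ℝ) =
      ∑ p ∈ adjPairs G, if p.1 ∈ A ∪ B then (1 : ℝ) else 0 := by
    rw [sum_adjPairs_fst G fun v => if v ∈ A ∪ B then (1 : ℝ) else 0]
    simp only [mul_ite, mul_one, mul_zero, Finset.sum_ite_mem, Finset.univ_inter]
  have hind (S T : Finset V) (F : V → V → ℝ) : ∑ u ∈ S, ∑ v ∈ T, F u v =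
      ∑ u, ∑ v, if u ∈ S ∧ v ∈ T then F u v else 0 := by
    simp [ite_and, Finset.sum_ite_mem]
  rw [two_mul]
  nth_rewrite 2 [hcross]
  rw [hvol, ← Finset.sum_sub_distrib,
    sum_adjPairs G fun u v => (if u ∈ A ∪ B then (1 : ℝ) else 0) -
      if signInd A B u * (s u v * signInd A B v) = 1 then (1 : ℝ) else 0,
    hind A A, hind B B, hind A B, hind B A, hind (A ∪ B)]
  simp only [← Finset.sum_add_distrib]
  refine Finset.sum_congr rfl fun u _ => Finset.sum_congr rfl fun v _ => ?_
  by_cases hadj : G.Adj u v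
  swap
  · simp [hadj]
  have hu : u ∈ A → u ∉ B := fun h => Finset.disjoint_left.1 hAB h
  have hv : v ∈ A → v ∉ B := fun h => Finset.disjoint_left.1 hAB h
  have h1 : (1 : ℝ) ≠ -1 := by norm_num
  have h2 : (-1 : ℝ) ≠ 1 := by norm_num
  rcases hs u v hadj with h | h <;> by_cases huA : u ∈ A <;> by_cases hvA : v ∈ A <;>
    by_cases huB : u ∈ B <;> by_cases hvB : v ∈ B <;>
    simp_all [signInd]

theorem signedBeta_nonneg (A B : Finset V) : 0 ≤ signedBeta G s A B := by
  have hite (p : Prop) [Decidable p] : (0 : ℝ) ≤ if p then 1 else 0 := by split_ifs <;> norm_num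
  unfold signedBeta
  refine div_nonneg (add_nonneg (add_nonneg (add_nonneg ?_ ?_) (mul_nonneg zero_le_two ?_)) ?_)
    (Finset.sum_nonneg fun _ _ => Nat.cast_nonneg _)
  all_goals exact Finset.sum_nonneg fun _ _ => Finset.sum_nonneg fun _ _ => hite _

theorem signedCheeger_nonneg : 0 ≤ signedCheeger G s :=
  Real.sInf_nonneg (by rintro _ ⟨A, B, -, -, rfl⟩; exact signedBeta_nonneg G s A B)

theorem signedCheeger_le {A B : Finset V} (hAB : Disjoint A B) (hne : (A ∪ B).Nonempty) :
    signedCheeger G s ≤ signedBeta G s A B :=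
  csInf_le ⟨0, by rintro _ ⟨A, B, -, -, rfl⟩; exact signedBeta_nonneg G s A B⟩
    ⟨A, B, hAB, hne, rfl⟩

end Beta

/-- Layer-cake principle: a linear inequality between indicators of superlevel sets integrates to
the same inequality between the levels. -/
theorem sum_mul_le_sum_mul_of_indicator {ι κ : Type*} (S : Finset ι) (T : Finset κ)
    (c y : ι → ℝ) (e z : κ → ℝ) (hy : ∀ i, 0 ≤ y i) (hz : ∀ k, 0 ≤ z k)
    (h : ∀ t : ℝ, 0 ≤ t → ∑ k ∈ T, e k * (if t < z k then 1 else 0) ≤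
      ∑ i ∈ S, c i * (if t < y i then 1 else 0)) :
    ∑ k ∈ T, e k * z k ≤ ∑ i ∈ S, c i * y i := by
  obtain ⟨M, hM0, hMy, hMz⟩ : ∃ M : ℝ, 0 ≤ M ∧ (∀ i ∈ S, y i ≤ M) ∧ ∀ k ∈ T, z k ≤ M := by
    refine ⟨∑ i ∈ S, y i + ∑ k ∈ T, z k, ?_, fun i hi => ?_, fun k hk => ?_⟩
    · exact add_nonneg (Finset.sum_nonneg fun i _ => hy i) (Finset.sum_nonneg fun k _ => hz k)
    · exact (Finset.single_le_sum (fun i _ => hy i) hi).trans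
        (le_add_of_nonneg_right (Finset.sum_nonneg fun k _ => hz k))
    · exact (Finset.single_le_sum (fun k _ => hz k) hk).trans
        (le_add_of_nonneg_left (Finset.sum_nonneg fun i _ => hy i))
  have hint (a : ℝ) : IntervalIntegrable (fun t : ℝ => if t < a then (1 : ℝ) else 0)
      MeasureTheory.volume 0 M := by
    refine AntitoneOn.intervalIntegrable (Antitone.antitoneOn (fun t t' htt => ?_) _)
    split_ifs <;> linarith
  have hval (a : ℝ) (h0 : 0 ≤ a) (ha : a ≤ M) :
      ∫ t in (0 : ℝ)..M, (if t < a then (1 : ℝ) else 0) = a := by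
    rw [intervalIntegral.integral_of_le hM0, MeasureTheory.integral_Ioc_eq_integral_Ioo]
    have : (fun t : ℝ => if t < a then (1 : ℝ) else 0) = (Set.Iio a).indicator fun _ => 1 := by
      ext t; simp [Set.indicator]
    rw [this, MeasureTheory.setIntegral_indicator measurableSet_Iio]
    have hset : Set.Ioo 0 M ∩ Set.Iio a = Set.Ioo 0 a := by
      ext t; simp only [Set.mem_inter_iff, Set.mem_Ioo, Set.mem_Iio]
      exact ⟨fun h => ⟨h.1.1, h.2⟩, fun h => ⟨⟨h.1, h.2.trans_le ha⟩, h.2⟩⟩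
    rw [hset]
    simp [h0]
  have key := intervalIntegral.integral_mono_on hM0
    (by simpa only [Finset.sum_fn] using
      IntervalIntegrable.sum T fun k _ => (hint (z k)).const_mul (e k))
    (by simpa only [Finset.sum_fn] using
      IntervalIntegrable.sum S fun i _ => (hint (y i)).const_mul (c i))
    (fun t ht => h t ht.1)
  rw [intervalIntegral.integral_finsetSum fun k _ => (hint (z k)).const_mul (e k),
    intervalIntegral.integral_finsetSum fun i _ => (hint (y i)).const_mul (c i)] at key
  simp only [intervalIntegral.integral_const_mul] at key
  rwa [Finset.sum_congr rfl fun k hk => by rw [hval (z k) (hz k) (hMz k hk)],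
    Finset.sum_congr (s₁ := S) rfl fun i hi => by rw [hval (y i) (hy i) (hMy i hi)]] at key

section Cheeger

variable {V : Type*} [Fintype V] [DecidableEq V] (G : SimpleGraph V) [DecidableRel G.Adj]
  (s : V → V → ℝ)

/-- The coarea estimate, obtained from the superlevel sets of `f ^ 2`. -/
theorem sum_min_sq_le (hiso : ∀ v, 0 < G.degree v)
    (hs : ∀ u v, G.Adj u v → s u v = 1 ∨ s u v = -1) (hss : ∀ u v, s u v = s v u) (f : V → ℝ) :
    (∑ p ∈ adjPairs G, if 0 < f p.1 * (s p.1 p.2 * f p.2) then min (f p.1 ^ 2) (f p.2 ^ 2) else 0)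
      ≤ (1 - signedCheeger G s) * ∑ v, (G.degree v : ℝ) * f v ^ 2 := by
  have key := sum_mul_le_sum_mul_of_indicator Finset.univ (adjPairs G)
    (fun v => (1 - signedCheeger G s) * (G.degree v : ℝ)) (fun v => f v ^ 2) (fun _ => 1)
    (fun p => if 0 < f p.1 * (s p.1 p.2 * f p.2) then min (f p.1 ^ 2) (f p.2 ^ 2) else 0)
    (fun v => sq_nonneg _) (fun p => by split_ifs <;> positivity) ?_
  · simpa only [one_mul, mul_assoc, ← Finset.mul_sum] using key
  intro t ht
  set A : Finset V := Finset.univ.filter fun v => t < f v ^ 2 ∧ 0 < f v with hA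
  set B : Finset V := Finset.univ.filter fun v => t < f v ^ 2 ∧ f v < 0 with hB
  have hAB : Disjoint A B := by
    rw [Finset.disjoint_left]
    intro v hv hv'
    simp only [hA, hB, Finset.mem_filter_univ] at hv hv'
    linarith [hv.2, hv'.2]
  have hU (v : V) : v ∈ A ∪ B ↔ t < f v ^ 2 := by
    simp only [hA, hB, Finset.mem_union, Finset.mem_filter_univ, ← and_or_left,
      and_iff_left_iff_imp]
    intro hv
    have : f v ≠ 0 := by rintro h0; rw [h0] at hv; norm_num at hv; linarith
    exact this.symm.lt_or_gt
  have hvol : ∑ v, (1 - signedCheeger G s) * (G.degree v : ℝ) * (if t < f v ^ 2 then 1 else 0) =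
      (1 - signedCheeger G s) * ∑ v ∈ A ∪ B, (G.degree v : ℝ) := by
    rw [Finset.mul_sum, ← Finset.sum_filter_add_sum_filter_not Finset.univ (· ∈ A ∪ B)]
    simp only [hU]
    rw [Finset.sum_congr rfl fun v hv => by rw [if_pos (Finset.mem_filter.1 hv).2],
      Finset.sum_congr (s₁ := Finset.univ.filter fun v => ¬ t < f v ^ 2) rfl
        fun v hv => by rw [if_neg (Finset.mem_filter.1 hv).2]]
    have : A ∪ B = Finset.univ.filter fun v => t < f v ^ 2 := by ext v; simp [hU]
    simp [this]
  have hgood : (∑ p ∈ adjPairs G, (1 : ℝ) * (if t < (if 0 < f p.1 * (s p.1 p.2 * f p.2) then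
      min (f p.1 ^ 2) (f p.2 ^ 2) else 0) then 1 else 0)) ≤ ∑ p ∈ adjPairs G,
        if signInd A B p.1 * (s p.1 p.2 * signInd A B p.2) = 1 then (1 : ℝ) else 0 := by
    refine Finset.sum_le_sum fun p hp => ?_
    rw [one_mul]
    by_cases hpos : 0 < f p.1 * (s p.1 p.2 * f p.2)
    swap
    · rw [if_neg hpos, if_neg ht.not_gt]
      split_ifs <;> norm_num
    rw [if_pos hpos]
    by_cases hm : t < min (f p.1 ^ 2) (f p.2 ^ 2)
    swap
    · rw [if_neg hm]
      split_ifs <;> norm_num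
    obtain ⟨h1, h2⟩ := lt_min_iff.1 hm
    rw [if_pos hm, if_pos]
    have hsign (v : V) (hv : t < f v ^ 2) : (0 < f v ∧ signInd A B v = 1) ∨
        (f v < 0 ∧ signInd A B v = -1) := by
      rcases lt_trichotomy (f v) 0 with h | h | h
      · exact Or.inr ⟨h, by simp [signInd, hA, hB, hv, h, h.le]⟩
      · rw [h] at hv; norm_num at hv; linarith
      · exact Or.inl ⟨h, by simp [signInd, hA, hB, hv, h, h.le]⟩
    rcases hs _ _ (Finset.mem_filter.1 hp).2 with hσ | hσ <;>
      rcases hsign _ h1 with ⟨h3, h4⟩ | ⟨h3, h4⟩ <;>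
      rcases hsign _ h2 with ⟨h5, h6⟩ | ⟨h5, h6⟩ <;>
      rw [hσ] at hpos ⊢ <;> rw [h4, h6] <;> norm_num <;> nlinarith
  refine hgood.trans (le_of_le_of_eq ?_ hvol.symm)
  rcases (A ∪ B).eq_empty_or_nonempty with hem | hne
  · obtain ⟨hA0, hB0⟩ := Finset.union_eq_empty.1 hem
    simp [hA0, hB0, signInd]
  · have := mul_le_mul_of_nonneg_right (signedCheeger_le G s hAB hne)
      (sum_degree_pos G hiso hne).le
    rw [signedBeta_mul_vol G s hiso hs hss hAB hne] at this
    linarith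

/-- The lower Cheeger estimate for an eigenfunction of norm one. -/
theorem one_sub_sqrt_le_eigenvalue (hiso : ∀ v, 0 < G.degree v)
    (hs : ∀ u v, G.Adj u v → s u v = 1 ∨ s u v = -1) (hss : ∀ u v, s u v = s v u)
    {f : V → ℝ} {μ : ℝ} (hf : slap G s f = μ • f)
    (hnorm : ∑ v, (G.degree v : ℝ) * f v * f v = 1) :
    1 - Real.sqrt (1 - signedCheeger G s ^ 2) ≤ μ := by
  have hnorm2 : ∑ v, (G.degree v : ℝ) * f v ^ 2 = 1 := by
    rw [← hnorm]; exact Finset.sum_congr rfl fun v _ => by ring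
  have hE := sum_degree_mul_slap G hiso s f f
  have hμ : ∑ v, (G.degree v : ℝ) * f v * slap G s f v = μ := by
    rw [hf]
    refine Eq.trans ?_ (mul_one μ)
    rw [← hnorm, Finset.mul_sum]
    exact Finset.sum_congr rfl fun v _ => by simp only [Pi.smul_apply, smul_eq_mul]; ring
  rw [hμ, hnorm] at hE
  set T := ∑ p ∈ adjPairs G, max (f p.1 * (s p.1 p.2 * f p.2)) 0 with hT
  set K := ∑ p ∈ adjPairs G,
    if 0 < f p.1 * (s p.1 p.2 * f p.2) then min (f p.1 ^ 2) (f p.2 ^ 2) else 0 with hK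
  have hTle : ∑ p ∈ adjPairs G, f p.1 * (s p.1 p.2 * f p.2) ≤ T :=
    Finset.sum_le_sum fun p _ => le_max_left _ _
  have hKle : K ≤ 1 - signedCheeger G s := by
    simpa only [hnorm2, mul_one] using sum_min_sq_le G s hiso hs hss f
  have hsq : ∑ p ∈ adjPairs G, (f p.1 ^ 2 + f p.2 ^ 2) = 2 := by
    rw [Finset.sum_add_distrib, sum_adjPairs_fst G fun v => f v ^ 2,
      sum_adjPairs_snd G fun v => f v ^ 2, hnorm2]
    norm_num
  have hσ (p : V × V) (hp : p ∈ adjPairs G) : (s p.1 p.2 * f p.2) ^ 2 = f p.2 ^ 2 := by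
    rcases hs _ _ (Finset.mem_filter.1 hp).2 with h | h <;> rw [h] <;> ring
  have hCS := Finset.sum_sq_le_sum_mul_sum_of_sq_le_mul (adjPairs G)
    (r := fun p => f p.1 ^ 2 + f p.2 ^ 2 - 2 *
      if 0 < f p.1 * (s p.1 p.2 * f p.2) then min (f p.1 ^ 2) (f p.2 ^ 2) else 0)
    (f := fun p => f p.1 ^ 2 + f p.2 ^ 2 - 2 * max (f p.1 * (s p.1 p.2 * f p.2)) 0)
    (g := fun p => f p.1 ^ 2 + f p.2 ^ 2 + 2 * max (f p.1 * (s p.1 p.2 * f p.2)) 0)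
    (fun p hp => by
      rw [← hσ p hp]
      rcases max_choice (f p.1 * (s p.1 p.2 * f p.2)) 0 with h | h <;> rw [h] <;>
        nlinarith [sq_nonneg (f p.1 - s p.1 p.2 * f p.2), sq_nonneg (f p.1),
          sq_nonneg (s p.1 p.2 * f p.2)])
    (fun p hp => by
      have := le_max_right (f p.1 * (s p.1 p.2 * f p.2)) 0
      positivity)
    (fun p hp => by
      rw [← hσ p hp]
      refine le_of_eq ?_
      split_ifs with h
      · rw [max_eq_left h.le]
        rcases min_choice (f p.1 ^ 2) ((s p.1 p.2 * f p.2) ^ 2) with h' | h' <;> rw [h'] <;> ring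
      · rw [max_eq_right (not_lt.1 h)]
        ring)
  simp only [Finset.sum_sub_distrib,
    Finset.sum_add_distrib (f := fun p : V × V => f p.1 ^ 2 + f p.2 ^ 2),
    ← Finset.mul_sum, hsq, ← hT, ← hK] at hCS
  have hh := signedCheeger_nonneg G s
  have hK2 : signedCheeger G s ^ 2 ≤ (1 - K) ^ 2 := pow_le_pow_left₀ hh (by linarith) 2
  have hT2 : T ^ 2 ≤ 1 - signedCheeger G s ^ 2 := by nlinarith
  linarith [Real.le_sqrt_of_sq_le hT2]

/-- A Rayleigh quotient bound: testing against `signInd A B`. -/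
theorem le_two_mul_signedCheeger [Nonempty V] (hiso : ∀ v, 0 < G.degree v)
    (hs : ∀ u v, G.Adj u v → s u v = 1 ∨ s u v = -1) (hss : ∀ u v, s u v = s v u) {μ : ℝ}
    (hμ : ∀ f : V → ℝ, μ * ∑ v, (G.degree v : ℝ) * f v * f v ≤
      ∑ v, (G.degree v : ℝ) * f v * slap G s f v) :
    μ ≤ 2 * signedCheeger G s := by
  suffices h : μ / 2 ≤ signedCheeger G s by linarith
  refine le_csInf ⟨_, Finset.univ, ∅, Finset.disjoint_empty_right _, by simp, rfl⟩ ?_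
  rintro _ ⟨A, B, hAB, hne, rfl⟩
  have hvpos := sum_degree_pos G hiso hne
  refine le_of_mul_le_mul_right ?_ hvpos
  have hβ := signedBeta_mul_vol G s hiso hs hss hAB hne
  have hR := hμ (signInd A B)
  rw [sum_degree_mul_slap G hiso] at hR
  have hx (v : V) : signInd A B v * signInd A B v = if v ∈ A ∪ B then 1 else 0 := by
    have := fun h : v ∈ A => Finset.disjoint_left.1 hAB h
    by_cases hA : v ∈ A <;> by_cases hB : v ∈ B <;> simp_all [signInd]
  have hvol : ∑ v, (G.degree v : ℝ) * signInd A B v * signInd A B v =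
      ∑ v ∈ A ∪ B, (G.degree v : ℝ) := by
    simp only [mul_assoc, hx, mul_ite, mul_one, mul_zero, Finset.sum_ite_mem, Finset.univ_inter]
  have hpair : ∑ p ∈ adjPairs G, (-(signInd A B p.1 * (s p.1 p.2 * signInd A B p.2)) + 2 *
      if signInd A B p.1 * (s p.1 p.2 * signInd A B p.2) = 1 then (1 : ℝ) else 0) ≤
      ∑ v ∈ A ∪ B, (G.degree v : ℝ) := by
    rw [← hvol]
    simp only [mul_assoc]
    rw [← sum_adjPairs_fst G fun v => signInd A B v * signInd A B v]
    refine Finset.sum_le_sum fun p hp => ?_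
    have hval (v : V) : signInd A B v = 0 ∨ signInd A B v = 1 ∨ signInd A B v = -1 := by
      by_cases hA : v ∈ A <;> by_cases hB : v ∈ B <;> simp [signInd, hA, hB]
    rcases hs _ _ (Finset.mem_filter.1 hp).2 with h | h <;>
      rcases hval p.1 with h1 | h1 | h1 <;> rcases hval p.2 with h2 | h2 | h2 <;>
      rw [h, h1, h2] <;> norm_num
  rw [Finset.sum_add_distrib, Finset.sum_neg_distrib, ← Finset.mul_sum] at hpair
  rw [hvol] at hR
  linarith

end Cheeger

/-- The smallest eigenvalue of an orthonormal eigenbasis bounds the Rayleigh quotient below. -/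
theorem mul_sum_le_of_eigenbasis {V ι : Type*} [Fintype V] [Fintype ι] [DecidableEq ι]
    (hcard : Fintype.card ι = Fintype.card V) (d : V → ℝ) (L : (V → ℝ) →ₗ[ℝ] V → ℝ)
    {lam : ι → ℝ} {u : ι → V → ℝ} (heig : ∀ i, L (u i) = lam i • u i)
    (horth : ∀ i j, (∑ v, d v * u i v * u j v) = if i = j then 1 else 0)
    {μ : ℝ} (hμ : ∀ i, μ ≤ lam i) (f : V → ℝ) :
    μ * ∑ v, d v * f v * f v ≤ ∑ v, d v * f v * L f v := by
  have hpair (a b : ι → ℝ) : ∑ v, d v * (∑ i, a i • u i) v * (∑ j, b j • u j) v =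
      ∑ i, a i * b i := by
    have h1 (v : V) : d v * (∑ i, a i • u i) v * (∑ j, b j • u j) v =
        ∑ i, ∑ j, a i * b j * (d v * u i v * u j v) := by
      simp only [Finset.sum_apply, Pi.smul_apply, smul_eq_mul]
      rw [mul_assoc, Finset.sum_mul_sum, Finset.mul_sum]
      simp only [Finset.mul_sum]
      exact Finset.sum_congr rfl fun i _ => Finset.sum_congr rfl fun j _ => by ring
    simp only [h1]
    rw [Finset.sum_comm]
    refine Finset.sum_congr rfl fun i _ => ?_
    rw [Finset.sum_comm]
    simp only [← Finset.mul_sum, horth]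
    simp
  have hli : LinearIndependent ℝ u := by
    rw [Fintype.linearIndependent_iff]
    intro g hg
    have h := hpair g g
    rw [hg] at h
    simp only [Pi.zero_apply, mul_zero, Finset.sum_const_zero] at h
    intro i
    have := (Finset.sum_eq_zero_iff_of_nonneg fun i _ => mul_self_nonneg (g i)).1 h.symm i
      (Finset.mem_univ i)
    exact mul_self_eq_zero.1 this
  have hspan := hli.span_eq_top_of_card_eq_finrank' (by simpa using hcard)
  obtain ⟨c, rfl⟩ := (Submodule.mem_span_range_iff_exists_fun ℝ).1
    (hspan ▸ Submodule.mem_top : f ∈ Submodule.span ℝ (Set.range u))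
  have hL : L (∑ i, c i • u i) = ∑ i, (c i * lam i) • u i := by
    simp only [map_sum, map_smul, heig, smul_smul]
  rw [hL, hpair, hpair, Finset.mul_sum]
  exact Finset.sum_le_sum fun i _ => by nlinarith [hμ i, mul_self_nonneg (c i)]

/-- `slap` as a linear map. -/
noncomputable def slapLinear {V : Type*} [Fintype V] (G : SimpleGraph V) [DecidableRel G.Adj]
    (s : V → V → ℝ) : (V → ℝ) →ₗ[ℝ] V → ℝ where
  toFun := slap G s
  map_add' f g := by
    ext v
    simp only [slap, Pi.add_apply, mul_add, Finset.sum_add_distrib]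
    ring
  map_smul' c f := by
    ext v
    simp only [slap, Pi.smul_apply, smul_eq_mul, RingHom.id_apply, mul_left_comm _ c,
      ← Finset.mul_sum]
    ring

/-- The signed Cheeger inequality (Atay–Liu): `1 − √(1 − (h₁^s)²) ≤ λ₁ ≤ 2h₁^s`, where `λ₁` is
the smallest eigenvalue of the signed normalized Laplacian. The eigenvalues are encoded by a
monotone list `lam` together with an eigenbasis `u`, orthonormal with respect to the
degree-weighted inner product. -/
theorem stmt8 {V : Type*} [Fintype V] [DecidableEq V] [Nonempty V]
    (G : SimpleGraph V) [DecidableRel G.Adj]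
    (hiso : ∀ v, 0 < G.degree v)
    (s : V → V → ℝ)
    (hs : ∀ u v, G.Adj u v → s u v = 1 ∨ s u v = -1)
    (hss : ∀ u v, s u v = s v u)
    (lam : Fin (Fintype.card V) → ℝ) (hmono : Monotone lam)
    (u : Fin (Fintype.card V) → V → ℝ)
    (heig : ∀ i, slap G s (u i) = lam i • u i)
    (horth : ∀ i j, (∑ v, (G.degree v : ℝ) * u i v * u j v) = if i = j then 1 else 0) :
    1 - Real.sqrt (1 - signedCheeger G s ^ 2) ≤ lam ⟨0, Fintype.card_pos⟩ ∧
      lam ⟨0, Fintype.card_pos⟩ ≤ 2 * signedCheeger G s := by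
  refine ⟨one_sub_sqrt_le_eigenvalue G s hiso hs hss (heig _) (by rw [horth, if_pos rfl]),
    le_two_mul_signedCheeger G s hiso hs hss fun f => ?_⟩
  exact mul_sum_le_of_eigenbasis (Fintype.card_fin _) (fun v => (G.degree v : ℝ))
    (slapLinear G s) heig horth (fun i => hmono (Nat.zero_le _)) f
end

section
/- Let Σ be a finite abstract simplicial complex on a linearly ordered vertex set and k ≥ 0 with deg σ > 0 for all σ ∈ Σ_k. Then h₁(Σ_k)² / (2(k+1)) ≤ k + 2 − λ_max(Δ_k^up) ≤ 2·h₁(Σ_k), where λ_max(Δ_k^up) is the largest eigenvalue of the normalized up-Laplacian and h₁(Σ_k) is the first Cheeger constant of the associated signed graph on Σ_k. -/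
open scoped BigOperators

/-- A finite abstract simplicial complex: a collection of nonempty finite vertex sets closed
under taking nonempty subsets. -/
def IsSimplicialComplex {U : Type*} [LinearOrder U] (K : Finset (Finset U)) : Prop :=
  (∀ σ ∈ K, σ.Nonempty) ∧ ∀ τ ∈ K, ∀ σ ⊆ τ, σ.Nonempty → σ ∈ K

/-- The set `Σ_k` of `k`-simplices (sets of `k+1` vertices) of `K`. -/
def faces {U : Type*} [LinearOrder U] (K : Finset (Finset U)) (k : ℕ) : Finset (Finset U) :=
  K.filter fun σ => σ.card = k + 1

/-- The degree of a simplex `σ`: the number of cofacets of `σ` in `K`. -/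
def degS {U : Type*} [LinearOrder U] (K : Finset (Finset U)) (σ : Finset U) : ℕ :=
  (K.filter fun τ => σ ⊆ τ ∧ τ.card = σ.card + 1).card

/-- The incidence sign `sgn([σ], ∂[τ]) = (−1)^i` when the vertex of `τ` missing from `σ` is the
`(i+1)`-st smallest vertex of `τ` (and `0` if `τ ∖ σ` is not a singleton). -/
def sgnZ {U : Type*} [LinearOrder U] (σ τ : Finset U) : ℤ :=
  ∑ v ∈ τ \ σ, (-1 : ℤ) ^ (τ.filter fun x => x < v).card

/-- The matrix of the normalized up-Laplacian `Δ_k^up` acting on `k`-cochains: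
`(Δ_k^up f)(σ) = f(σ) + (1/deg σ) Σ_{σ'≠σ, common cofacet τ} sgn([σ],∂[τ]) sgn([σ'],∂[τ]) f(σ')`
(each pair of distinct `k`-simplices has at most one common cofacet `τ ∈ Σ_{k+1}`). -/
noncomputable def upLapMatrix {U : Type*} [LinearOrder U] (K : Finset (Finset U)) (k : ℕ) :
    Matrix {σ // σ ∈ faces K k} {σ // σ ∈ faces K k} ℝ :=
  fun σ σ' =>
    if σ = σ' then 1
    else (degS K σ.1 : ℝ)⁻¹ *
      ∑ τ ∈ K.filter (fun τ => τ.card = k + 2 ∧ σ.1 ⊆ τ ∧ σ'.1 ⊆ τ),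
        (sgnZ σ.1 τ : ℝ) * (sgnZ σ'.1 τ : ℝ)

/-- The sign `s(σ,σ') = sgn([σ],∂[τ])·sgn([σ'],∂[τ])` of the edge between two `k`-simplices
sharing the (unique) common cofacet `τ ∈ Σ_{k+1}` (`0` if there is no common cofacet). -/
def sprodZ {U : Type*} [LinearOrder U] (K : Finset (Finset U)) (k : ℕ)
    (σ σ' : Finset U) : ℤ :=
  ∑ τ ∈ K.filter (fun τ => τ.card = k + 2 ∧ σ ⊆ τ ∧ σ' ⊆ τ), sgnZ σ τ * sgnZ σ' τ

/-- The bipartiteness ratio `β(A,A')` of a pair of disjoint subsets of `Σ_k`: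
`[2(|E⁻(A)| + |E⁻(A')| + |E⁺(A,A')|) + |∂(A⊔A')|] / Vol(A⊔A')` in the signed graph on `Σ_k`
with sign `s(σ,σ')`. (Sums over ordered pairs count each edge inside a set twice.) -/
noncomputable def betaS {U : Type*} [LinearOrder U] (K : Finset (Finset U)) (k : ℕ)
    (A A' : Finset (Finset U)) : ℝ :=
  ((∑ σ ∈ A, ∑ σ' ∈ A, if σ' ≠ σ ∧ sprodZ K k σ σ' = -1 then (1 : ℝ) else 0) +
    (∑ σ ∈ A', ∑ σ' ∈ A', if σ' ≠ σ ∧ sprodZ K k σ σ' = -1 then (1 : ℝ) else 0) +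
    2 * (∑ σ ∈ A, ∑ σ' ∈ A', if σ' ≠ σ ∧ sprodZ K k σ σ' = 1 then (1 : ℝ) else 0) +
    (∑ σ ∈ A ∪ A', ∑ σ' ∈ faces K k \ (A ∪ A'),
      if σ' ≠ σ ∧ sprodZ K k σ σ' ≠ 0 then (1 : ℝ) else 0)) /
    ∑ σ ∈ A ∪ A', (degS K σ : ℝ)

/-- The first Cheeger constant `h₁(Σ_k)`: the minimum of `β(A,A')` over pairs of disjoint
subsets `(A,A')` of `Σ_k` with `A ∪ A' ≠ ∅`. -/
noncomputable def h1S {U : Type*} [LinearOrder U] (K : Finset (Finset U)) (k : ℕ) : ℝ :=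
  sInf { r : ℝ | ∃ A A' : Finset (Finset U), A ⊆ faces K k ∧ A' ⊆ faces K k ∧
    Disjoint A A' ∧ (A ∪ A').Nonempty ∧ r = betaS K k A A' }

/-- The quadratic form of a signed graph with weighted degrees `c * d`. -/
theorem half_sum_abs_mul_sub_sq {V : Type*} [Fintype V] (d : V → ℝ) (s : V → V → ℝ) (c : ℝ)
    (hsymm : ∀ i j, s i j = s j i) (hs : ∀ i j, s i j = 0 ∨ s i j = 1 ∨ s i j = -1)
    (hsum : ∀ i, ∑ j, |s i j| = c * d i) (x : V → ℝ) :
    (∑ i, ∑ j, |s i j| * (x i - s i j * x j) ^ 2) / 2 =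
      c * ∑ i, d i * x i ^ 2 - ∑ i, ∑ j, s i j * x i * x j := by
  have h1 : ∑ i, ∑ j, |s i j| * x i ^ 2 = c * ∑ i, d i * x i ^ 2 := by
    rw [Finset.mul_sum]
    refine Finset.sum_congr rfl fun i _ => ?_
    rw [← Finset.sum_mul, hsum]; ring
  have h2 : ∑ i, ∑ j, |s i j| * x j ^ 2 = c * ∑ i, d i * x i ^ 2 := by
    rw [Finset.sum_comm, ← h1]
    simp only [hsymm]
  have h3 : ∑ i, ∑ j, |s i j| * (x i - s i j * x j) ^ 2 =
      ∑ i, ∑ j, (|s i j| * x i ^ 2 + |s i j| * x j ^ 2 - 2 * (s i j * x i * x j)) := by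
    refine Finset.sum_congr rfl fun i _ => Finset.sum_congr rfl fun j _ => ?_
    rcases hs i j with h | h | h <;> rw [h] <;> simp <;> ring
  rw [h3]
  simp only [Finset.sum_sub_distrib, Finset.sum_add_distrib, h1, h2, ← Finset.mul_sum]
  ring

/-- Rayleigh bound for the largest eigenvalue of a normalized signed matrix. -/
theorem rayleigh_le_of_forall_hasEigenvalue_le {V : Type*} [Fintype V] [DecidableEq V]
    (d : V → ℝ) (s : V → V → ℝ) (hd : ∀ i, 0 < d i)
    (hsymm : ∀ i j, s i j = s j i) (M : Matrix V V ℝ)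
    (hM : ∀ i j, M i j = (if i = j then 1 else 0) + (d i)⁻¹ * s i j) (lam : ℝ)
    (hmax : ∀ μ : ℝ, Module.End.HasEigenvalue M.mulVecLin μ → μ ≤ lam) (x : V → ℝ) :
    ∑ i, d i * x i ^ 2 + ∑ i, ∑ j, s i j * x i * x j ≤ lam * ∑ i, d i * x i ^ 2 := by
  have hr : ∀ i, 0 < √(d i) := fun i => Real.sqrt_pos.2 (hd i)
  have hrr : ∀ i, √(d i) * √(d i) = d i := fun i => Real.mul_self_sqrt (hd i).le
  let C : Matrix V V ℝ := fun i j =>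
    (if i = j then lam - 1 else 0) - (√(d i))⁻¹ * (√(d j))⁻¹ * s i j
  have hC : C.IsHermitian := by
    refine Matrix.IsHermitian.ext fun i j => ?_
    simp only [C, star_trivial, hsymm j i, eq_comm (a := j)]
    ring
  have hmul : ∀ (v : V → ℝ) i, C.mulVec v i =
      (lam - 1) * v i - (√(d i))⁻¹ * ∑ j, s i j * ((√(d j))⁻¹ * v j) := by
    intro v i
    simp only [Matrix.mulVec, dotProduct, C, sub_mul, Finset.sum_sub_distrib, ite_mul, zero_mul,
      Finset.sum_ite_eq, Finset.mem_univ, if_true, Finset.mul_sum]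
    congr 1
    refine Finset.sum_congr rfl fun j _ => by ring
  have hMmul : ∀ (v : V → ℝ) i, M.mulVec v i = v i + (d i)⁻¹ * ∑ j, s i j * v j := by
    intro v i
    simp only [Matrix.mulVec, dotProduct, hM, add_mul, Finset.sum_add_distrib, ite_mul, zero_mul,
      one_mul, Finset.sum_ite_eq, Finset.mem_univ, if_true, Finset.mul_sum]
    congr 1
    refine Finset.sum_congr rfl fun j _ => by ring
  have hpos : C.PosSemidef := by
    rw [hC.posSemidef_iff_eigenvalues_nonneg]
    intro e
    have hv := hC.mulVec_eigenvectorBasis e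
    set v : V → ℝ := ⇑(hC.eigenvectorBasis e) with hvdef
    have hv0 : v ≠ 0 := by
      intro h0
      apply hC.eigenvectorBasis.orthonormal.ne_zero e
      ext i
      exact congrFun h0 i
    have := hmax (lam - hC.eigenvalues e) (by
      refine Module.End.hasEigenvalue_of_hasEigenvector (x := fun i => (√(d i))⁻¹ * v i)
        ⟨Module.End.mem_eigenspace_iff.2 ?_, ?_⟩
      · ext i
        have h1 := congrFun hv i
        rw [hmul] at h1
        simp only [Pi.smul_apply, smul_eq_mul] at h1
        simp only [Matrix.mulVecLin_apply, hMmul, Pi.smul_apply, smul_eq_mul]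
        have h2 : (d i)⁻¹ = (√(d i))⁻¹ * (√(d i))⁻¹ := by rw [← mul_inv, hrr]
        rw [h2]
        linear_combination -(√(d i))⁻¹ * h1
      · intro h0
        apply hv0
        ext i
        have h1 := congrFun h0 i
        simpa [(hr i).ne'] using h1)
    simp only [Pi.zero_apply]
    linarith
  have h := hpos.dotProduct_mulVec_nonneg (fun i => √(d i) * x i)
  simp only [dotProduct, hmul, Pi.star_apply, star_trivial] at h
  have hform : ∑ i, √(d i) * x i * ((lam - 1) * (√(d i) * x i) -
      (√(d i))⁻¹ * ∑ j, s i j * ((√(d j))⁻¹ * (√(d j) * x j))) =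
      (lam - 1) * ∑ i, d i * x i ^ 2 - ∑ i, ∑ j, s i j * x i * x j := by
    rw [Finset.mul_sum, ← Finset.sum_sub_distrib]
    refine Finset.sum_congr rfl fun i _ => ?_
    have h1 : ∑ j, s i j * ((√(d j))⁻¹ * (√(d j) * x j)) = ∑ j, s i j * x j :=
      Finset.sum_congr rfl fun j _ => by rw [inv_mul_cancel_left₀ (hr j).ne']
    have h2 : ∑ j, s i j * x i * x j = x i * ∑ j, s i j * x j := by
      rw [Finset.mul_sum]; exact Finset.sum_congr rfl fun j _ => by ring
    rw [h1, h2, mul_sub]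
    congr 1
    · linear_combination (lam - 1) * x i ^ 2 * hrr i
    · field_simp [(hr i).ne']
  rw [hform] at h
  linarith

/-- The signed indicator of the superlevel set `{t ≤ a²}`. -/
noncomputable def signedLevel (a t : ℝ) : ℝ := if t ≤ a ^ 2 then SignType.sign a else 0

theorem signedLevel_neg (a t : ℝ) : signedLevel (-a) t = -signedLevel a t := by
  unfold signedLevel
  rw [neg_sq, Left.sign_neg]
  split_ifs <;> simp

theorem abs_signedLevel {a t : ℝ} (ht : 0 < t) :
    |signedLevel a t| = if t ≤ a ^ 2 then 1 else 0 := by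
  unfold signedLevel
  split_ifs with h
  · rcases lt_trichotomy a 0 with ha | rfl | ha
    · simp [sign_neg ha]
    · norm_num at h; linarith
    · simp [sign_pos ha]
  · simp

theorem signedLevel_mem (a t : ℝ) :
    signedLevel a t = 0 ∨ signedLevel a t = 1 ∨ signedLevel a t = -1 := by
  unfold signedLevel
  split_ifs with h
  · rcases lt_trichotomy a 0 with ha | rfl | ha
    · simp [sign_neg ha]
    · simp
    · simp [sign_pos ha]
  · simp

theorem intervalIntegrable_indicator_le (c M : ℝ) :
    IntervalIntegrable (fun t : ℝ => if t ≤ c then (1 : ℝ) else 0) MeasureTheory.volume 0 M := by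
  apply AntitoneOn.intervalIntegrable
  intro a _ b _ hab
  dsimp only
  split_ifs <;> linarith

theorem integral_indicator_le {c M : ℝ} (hc : 0 ≤ c) (hcM : c ≤ M) :
    ∫ t in (0 : ℝ)..M, (if t ≤ c then (1 : ℝ) else 0) = c := by
  have := intervalIntegral.integral_indicator (a₁ := (0 : ℝ)) (a₂ := c) (a₃ := M)
    (f := fun _ => (1 : ℝ)) (μ := MeasureTheory.volume) ⟨hc, hcM⟩
  simpa [Set.indicator] using this

theorem abs_signedLevel_sub {a b : ℝ} (hab : b ^ 2 ≤ a ^ 2) {t : ℝ} (ht : 0 < t) :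
    |signedLevel a t - signedLevel b t| = (if t ≤ a ^ 2 then 1 else 0) +
      (if a * b < 0 then 1 else -1) * (if t ≤ b ^ 2 then 1 else 0) := by
  unfold signedLevel
  by_cases hb : t ≤ b ^ 2
  · have ha : t ≤ a ^ 2 := hb.trans hab
    have ha0 : a ≠ 0 := by rintro rfl; norm_num at ha; linarith
    have hb0 : b ≠ 0 := by rintro rfl; norm_num at hb; linarith
    rcases lt_or_gt_of_ne ha0 with h1 | h1 <;> rcases lt_or_gt_of_ne hb0 with h2 | h2
    · simp [ha, hb, sign_neg h1, sign_neg h2, (mul_pos_of_neg_of_neg h1 h2).not_gt]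
    · norm_num [ha, hb, sign_neg h1, sign_pos h2, mul_neg_of_neg_of_pos h1 h2]
    · simp [ha, hb, sign_pos h1, sign_neg h2, mul_neg_of_pos_of_neg h1 h2]
    · simp [ha, hb, sign_pos h1, sign_pos h2, (mul_pos h1 h2).not_gt]
  · have := abs_signedLevel (a := a) ht
    unfold signedLevel at this
    simpa [hb] using this

/-- The layer-cake estimate for one edge. -/
theorem integral_abs_signedLevel_sub_le {a b M : ℝ} (ha : a ^ 2 ≤ M) (hb : b ^ 2 ≤ M) :
    IntervalIntegrable (fun t => |signedLevel a t - signedLevel b t|)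
        MeasureTheory.volume 0 M ∧
      ∫ t in (0 : ℝ)..M, |signedLevel a t - signedLevel b t| ≤ |a - b| * (|a| + |b|) := by
  wlog hab : b ^ 2 ≤ a ^ 2 generalizing a b
  · have := this hb ha (le_of_not_ge hab)
    simpa only [abs_sub_comm, add_comm] using this
  have hM : 0 ≤ M := (sq_nonneg a).trans ha
  have heq : Set.EqOn (fun t => (if t ≤ a ^ 2 then (1 : ℝ) else 0) +
      (if a * b < 0 then 1 else -1) * (if t ≤ b ^ 2 then 1 else 0))
      (fun t => |signedLevel a t - signedLevel b t|) (Set.uIoc 0 M) := by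
    intro t ht
    rw [Set.uIoc_of_le hM] at ht
    exact (abs_signedLevel_sub hab ht.1).symm
  have hi := intervalIntegrable_indicator_le (a ^ 2) M
  have hj := (intervalIntegrable_indicator_le (b ^ 2) M).const_mul
    (if a * b < 0 then (1 : ℝ) else -1)
  refine ⟨(hi.add hj).congr heq, ?_⟩
  rw [← intervalIntegral.integral_congr_ae (Filter.Eventually.of_forall heq),
    intervalIntegral.integral_add hi hj, intervalIntegral.integral_const_mul,
    integral_indicator_le (sq_nonneg a) ha, integral_indicator_le (sq_nonneg b) hb]
  have hle : |b| ≤ |a| := sq_le_sq.1 hab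
  rw [← sq_abs a, ← sq_abs b]
  split_ifs with h
  · have : |a - b| = |a| + |b| := by
      rcases mul_neg_iff.1 h with ⟨h1, h2⟩ | ⟨h1, h2⟩
      · rw [abs_of_pos h1, abs_of_neg h2, abs_of_pos (by linarith)]; ring
      · rw [abs_of_neg h1, abs_of_pos h2, abs_of_neg (by linarith)]; ring
    rw [this]
    nlinarith [abs_nonneg a, abs_nonneg b]
  · nlinarith [abs_sub_abs_le_abs_sub a b, abs_nonneg a, abs_nonneg b]

/-- The Cheeger-type inequality for signed graphs: a lower bound on signed cuts gives a lower
bound on the quadratic form. -/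
theorem sq_mul_le_of_forall_signed_cut {V : Type*} [Fintype V] (d : V → ℝ) (s : V → V → ℝ)
    (c h : ℝ) (hc : 0 ≤ c) (hh : 0 ≤ h) (hd : ∀ i, 0 < d i)
    (hsymm : ∀ i j, s i j = s j i) (hs : ∀ i j, s i j = 0 ∨ s i j = 1 ∨ s i j = -1)
    (hsum : ∀ i, ∑ j, |s i j| = c * d i)
    (hcut : ∀ x : V → ℝ, (∀ i, x i = 0 ∨ x i = 1 ∨ x i = -1) →
      h * ∑ i, d i * |x i| ≤ (∑ i, ∑ j, |s i j| * |x i - s i j * x j|) / 2)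
    (f : V → ℝ) :
    h ^ 2 * ∑ i, d i * f i ^ 2 ≤
      2 * c * ((∑ i, ∑ j, |s i j| * (f i - s i j * f j) ^ 2) / 2) := by
  set D := ∑ i, d i * f i ^ 2 with hD
  set Q := ∑ i, ∑ j, |s i j| * (f i - s i j * f j) ^ 2 with hQ
  have hD0 : 0 ≤ D := Finset.sum_nonneg fun i _ => mul_nonneg (hd i).le (sq_nonneg _)
  have hQ0 : 0 ≤ Q := Finset.sum_nonneg fun i _ => Finset.sum_nonneg fun j _ => by positivity
  set M := ∑ i, f i ^ 2 with hM
  have hfM : ∀ i, f i ^ 2 ≤ M := fun i =>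
    Finset.single_le_sum (f := fun i => f i ^ 2) (fun j _ => sq_nonneg _) (Finset.mem_univ i)
  have hM0 : 0 ≤ M := Finset.sum_nonneg fun i _ => sq_nonneg _
  set L := ∑ i, ∑ j, |s i j| * (|f i - s i j * f j| * (|f i| + |f j|)) with hL
  have hedge : ∀ i j, IntervalIntegrable
      (fun t => |s i j| * |signedLevel (f i) t - s i j * signedLevel (f j) t|)
        MeasureTheory.volume 0 M ∧
      ∫ t in (0 : ℝ)..M, |s i j| * |signedLevel (f i) t - s i j * signedLevel (f j) t| ≤
        |s i j| * (|f i - s i j * f j| * (|f i| + |f j|)) := by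
    intro i j
    rcases hs i j with h0 | h0 | h0
    · simp [h0]
    · simpa [h0] using integral_abs_signedLevel_sub_le (hfM i) (hfM j)
    · have := integral_abs_signedLevel_sub_le (a := f i) (b := -f j) (hfM i)
        (by rw [neg_sq]; exact hfM j)
      simpa [h0, signedLevel_neg] using this
  have hlevel : h * D ≤ L / 2 := by
    have hleft : ∫ t in (0 : ℝ)..M, h * ∑ i, d i * (if t ≤ f i ^ 2 then (1 : ℝ) else 0) =
        h * D := by
      rw [intervalIntegral.integral_const_mul, intervalIntegral.integral_finsetSum
        fun i _ => (intervalIntegrable_indicator_le _ _).const_mul _]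
      congr 1
      refine Finset.sum_congr rfl fun i _ => ?_
      rw [intervalIntegral.integral_const_mul, integral_indicator_le (sq_nonneg _) (hfM i)]
    have hint : ∀ i ∈ Finset.univ, IntervalIntegrable
        (fun t => ∑ j, |s i j| * |signedLevel (f i) t - s i j * signedLevel (f j) t|)
        MeasureTheory.volume 0 M := fun i _ => by
      simpa only [Finset.sum_fn] using
        IntervalIntegrable.sum Finset.univ fun j _ => (hedge i j).1
    have hint' : IntervalIntegrable (fun t => ∑ i, ∑ j,
        |s i j| * |signedLevel (f i) t - s i j * signedLevel (f j) t|)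
        MeasureTheory.volume 0 M := by
      simpa only [Finset.sum_fn] using IntervalIntegrable.sum Finset.univ hint
    have hright : ∫ t in (0 : ℝ)..M, (∑ i, ∑ j,
        |s i j| * |signedLevel (f i) t - s i j * signedLevel (f j) t|) / 2 ≤ L / 2 := by
      rw [intervalIntegral.integral_div, intervalIntegral.integral_finsetSum hint]
      refine div_le_div_of_nonneg_right (Finset.sum_le_sum fun i _ => ?_) zero_le_two
      rw [intervalIntegral.integral_finsetSum fun j _ => (hedge i j).1]
      exact Finset.sum_le_sum fun j _ => (hedge i j).2
    rw [← hleft]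
    refine le_trans (intervalIntegral.integral_mono_on_of_le_Ioo hM0 ?_
      (hint'.div_const 2) fun t ht => ?_) hright
    · simpa only [Finset.sum_fn] using (IntervalIntegrable.sum Finset.univ fun i _ =>
        (intervalIntegrable_indicator_le (f i ^ 2) M).const_mul (d i)).const_mul h
    · have := hcut (fun i => signedLevel (f i) t) fun i => signedLevel_mem _ _
      simpa only [abs_signedLevel ht.1] using this
  have hCS : L ^ 2 ≤ Q * ∑ i, ∑ j, |s i j| * (|f i| + |f j|) ^ 2 := by
    simp only [hL, hQ, ← Fintype.sum_prod_type']
    refine Finset.sum_sq_le_sum_mul_sum_of_sq_le_mul _ (fun p _ => by positivity)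
      (fun p _ => by positivity) fun p _ => ?_
    rw [mul_pow, mul_pow, sq_abs (f p.1 - _)]
    exact le_of_eq (by ring)
  have hS : ∑ i, ∑ j, |s i j| * (|f i| + |f j|) ^ 2 ≤ 4 * c * D := by
    have h1 : ∑ i, ∑ j, |s i j| * f i ^ 2 = c * D := by
      rw [hD, Finset.mul_sum]
      refine Finset.sum_congr rfl fun i _ => ?_
      rw [← Finset.sum_mul, hsum]; ring
    have h2 : ∑ i, ∑ j, |s i j| * f j ^ 2 = c * D := by
      rw [Finset.sum_comm, ← h1]
      simp only [hsymm]
    calc ∑ i, ∑ j, |s i j| * (|f i| + |f j|) ^ 2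
        ≤ ∑ i, ∑ j, (2 * (|s i j| * f i ^ 2) + 2 * (|s i j| * f j ^ 2)) := by
          refine Finset.sum_le_sum fun i _ => Finset.sum_le_sum fun j _ => ?_
          have := mul_le_mul_of_nonneg_left (add_sq_le (a := |f i|) (b := |f j|))
            (abs_nonneg (s i j))
          rw [sq_abs, sq_abs] at this
          linarith
      _ = 4 * c * D := by
          simp only [Finset.sum_add_distrib, ← Finset.mul_sum, h1, h2]; ring
  have h1 : (h * D) ^ 2 ≤ (L / 2) ^ 2 := pow_le_pow_left₀ (by positivity) hlevel 2
  have h2 : Q * ∑ i, ∑ j, |s i j| * (|f i| + |f j|) ^ 2 ≤ Q * (4 * c * D) :=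
    mul_le_mul_of_nonneg_left hS hQ0
  rcases hD0.eq_or_lt with h0 | h0
  · rw [← h0, mul_zero]; positivity
  · refine le_of_mul_le_mul_right ?_ h0
    nlinarith

theorem sgnZ_eq_one_or_neg_one {U : Type*} [LinearOrder U] {σ τ : Finset U} (h : σ ⊆ τ)
    (hc : τ.card = σ.card + 1) : sgnZ σ τ = 1 ∨ sgnZ σ τ = -1 := by
  have : (τ \ σ).card = 1 := by rw [Finset.card_sdiff_of_subset h]; omega
  obtain ⟨v, hv⟩ := Finset.card_eq_one.1 this
  rw [sgnZ, hv, Finset.sum_singleton]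
  exact neg_one_pow_eq_or ℤ _

theorem sprodZ_comm {U : Type*} [LinearOrder U] (K : Finset (Finset U)) (k : ℕ)
    (σ σ' : Finset U) : sprodZ K k σ σ' = sprodZ K k σ' σ := by
  unfold sprodZ
  rw [Finset.filter_congr fun τ _ => and_congr_right fun _ => and_comm]
  exact Finset.sum_congr rfl fun τ _ => mul_comm _ _

theorem sprodZ_trichotomy {U : Type*} [LinearOrder U] (K : Finset (Finset U)) (k : ℕ)
    {σ σ' : Finset U} (hσ : σ.card = k + 1) (hσ' : σ'.card = k + 1) (hne : σ ≠ σ') :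
    (sprodZ K k σ σ' = 0 ∨ sprodZ K k σ σ' = 1 ∨ sprodZ K k σ σ' = -1) ∧
      |sprodZ K k σ σ'| =
        ((K.filter fun τ => τ.card = k + 2 ∧ σ ⊆ τ ∧ σ' ⊆ τ).card : ℤ) := by
  unfold sprodZ
  set T := K.filter fun τ => τ.card = k + 2 ∧ σ ⊆ τ ∧ σ' ⊆ τ with hT
  have hcard : k + 2 ≤ (σ ∪ σ').card := by
    have hss : σ ⊂ σ ∪ σ' := by
      refine Finset.ssubset_iff_subset_ne.2 ⟨Finset.subset_union_left, fun h => hne ?_⟩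
      refine (Finset.eq_of_subset_of_card_le (h ▸ Finset.subset_union_right) ?_).symm
      rw [hσ, hσ']
    have := Finset.card_lt_card hss
    omega
  have huniq : ∀ τ ∈ T, τ = σ ∪ σ' := fun τ hτ => by
    obtain ⟨_, h1, h2, h3⟩ := Finset.mem_filter.1 hτ
    exact (Finset.eq_of_subset_of_card_le (Finset.union_subset h2 h3) (by omega)).symm
  rcases T.eq_empty_or_nonempty with h0 | ⟨τ, hτ⟩
  · simp [h0]
  · have hT1 : T = {τ} := by
      refine Finset.eq_singleton_iff_unique_mem.2 ⟨hτ, fun ρ hρ => ?_⟩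
      rw [huniq ρ hρ, huniq τ hτ]
    obtain ⟨_, h1, h2, h3⟩ := Finset.mem_filter.1 hτ
    rw [hT1, Finset.sum_singleton, Finset.card_singleton]
    rcases sgnZ_eq_one_or_neg_one h2 (by omega) with ha | ha <;>
    rcases sgnZ_eq_one_or_neg_one h3 (by omega) with hb | hb <;>
    simp [ha, hb]

/-- The sign function of the signed graph on `k`-simplices, vanishing on the diagonal. -/
noncomputable def edgeSign {U : Type*} [LinearOrder U] (K : Finset (Finset U)) (k : ℕ)
    (σ σ' : Finset U) : ℝ :=
  if σ = σ' then 0 else (sprodZ K k σ σ' : ℝ)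

theorem edgeSign_comm {U : Type*} [LinearOrder U] (K : Finset (Finset U)) (k : ℕ)
    (σ σ' : Finset U) : edgeSign K k σ σ' = edgeSign K k σ' σ := by
  unfold edgeSign
  rw [sprodZ_comm]
  simp only [eq_comm]

theorem edgeSign_trichotomy {U : Type*} [LinearOrder U] (K : Finset (Finset U)) (k : ℕ)
    {σ σ' : Finset U} (hσ : σ ∈ faces K k) (hσ' : σ' ∈ faces K k) :
    edgeSign K k σ σ' = 0 ∨ edgeSign K k σ σ' = 1 ∨ edgeSign K k σ σ' = -1 := by
  unfold edgeSign
  split_ifs with h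
  · simp
  · have := (sprodZ_trichotomy K k (Finset.mem_filter.1 hσ).2 (Finset.mem_filter.1 hσ').2 h).1
    exact_mod_cast this

theorem sum_abs_edgeSign {U : Type*} [LinearOrder U] (K : Finset (Finset U))
    (hK : IsSimplicialComplex K) (k : ℕ) {σ : Finset U} (hσ : σ ∈ faces K k) :
    ∑ σ' ∈ faces K k, |edgeSign K k σ σ'| = ((k : ℝ) + 1) * degS K σ := by
  have hσc := (Finset.mem_filter.1 hσ).2
  have hcount : ∑ σ' ∈ (faces K k).erase σ,
      (K.filter fun τ => τ.card = k + 2 ∧ σ ⊆ τ ∧ σ' ⊆ τ).card = (k + 1) * degS K σ := by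
    have h1 := Finset.sum_card_bipartiteAbove_eq_sum_card_bipartiteBelow
      (s := (faces K k).erase σ) (t := K.filter fun τ => σ ⊆ τ ∧ τ.card = σ.card + 1)
      (fun σ' τ => σ' ⊆ τ)
    have h2 : ∀ σ', (K.filter fun τ => τ.card = k + 2 ∧ σ ⊆ τ ∧ σ' ⊆ τ) =
        Finset.bipartiteAbove (fun σ' τ => σ' ⊆ τ)
          (K.filter fun τ => σ ⊆ τ ∧ τ.card = σ.card + 1) σ' := by
      intro σ'
      ext τ
      simp only [Finset.bipartiteAbove, Finset.mem_filter, hσc]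
      tauto
    simp only [h2]
    rw [h1, degS, mul_comm, ← smul_eq_mul, ← Finset.sum_const]
    refine Finset.sum_congr rfl fun τ hτ => ?_
    obtain ⟨hτK, hsub, hτc⟩ := Finset.mem_filter.1 hτ
    have h3 : Finset.bipartiteBelow (fun σ' τ => σ' ⊆ τ) ((faces K k).erase σ) τ =
        (Finset.powersetCard (k + 1) τ).erase σ := by
      ext ρ
      simp only [Finset.bipartiteBelow, Finset.mem_filter, Finset.mem_erase, faces,
        Finset.mem_powersetCard]
      refine ⟨fun h => ⟨h.1.1, h.2, h.1.2.2⟩, fun h => ⟨⟨h.1, ?_, h.2.2⟩, h.2.1⟩⟩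
      exact hK.2 τ hτK ρ h.2.1 (Finset.card_pos.1 (by omega))
    rw [h3, Finset.card_erase_of_mem (Finset.mem_powersetCard.2 ⟨hsub, hσc⟩),
      Finset.card_powersetCard, hτc, hσc, Nat.choose_succ_self_right]
    rfl
  rw [← Finset.add_sum_erase _ _ hσ]
  have h0 : |edgeSign K k σ σ| = 0 := by simp [edgeSign]
  rw [h0, zero_add]
  have : ∀ σ' ∈ (faces K k).erase σ, |edgeSign K k σ σ'| =
      ((K.filter fun τ => τ.card = k + 2 ∧ σ ⊆ τ ∧ σ' ⊆ τ).card : ℝ) := by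
    intro σ' h
    obtain ⟨hne, hmem⟩ := Finset.mem_erase.1 h
    have := (sprodZ_trichotomy K k hσc (Finset.mem_filter.1 hmem).2 hne.symm).2
    rw [edgeSign, if_neg hne.symm]
    exact_mod_cast this
  rw [Finset.sum_congr rfl this]
  exact_mod_cast hcount

/-- The signed indicator `1_A - 1_{A'}` of a pair of sets. -/
noncomputable def signedIndicator {U : Type*} [LinearOrder U] (A A' : Finset (Finset U))
    (σ : Finset U) : ℝ :=
  if σ ∈ A then 1 else if σ ∈ A' then -1 else 0

/-- The bipartiteness ratio in terms of the signed indicator of the pair. -/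
theorem betaS_eq {U : Type*} [LinearOrder U] (K : Finset (Finset U)) (k : ℕ)
    {A A' : Finset (Finset U)} (hA : A ⊆ faces K k) (hA' : A' ⊆ faces K k)
    (hdisj : Disjoint A A') :
    betaS K k A A' = ((∑ σ ∈ faces K k, ∑ σ' ∈ faces K k, |edgeSign K k σ σ'| *
        |signedIndicator A A' σ - edgeSign K k σ σ' * signedIndicator A A' σ'|) / 2) /
      ∑ σ ∈ faces K k, degS K σ * |signedIndicator A A' σ| := by
  have hAA : A ∪ A' ⊆ faces K k := Finset.union_subset hA hA'
  have hsub : ∀ B ⊆ faces K k, ∀ g : Finset U → ℝ,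
      ∑ σ ∈ B, g σ = ∑ σ ∈ faces K k, if σ ∈ B then g σ else 0 := by
    intro B hB g
    rw [← Finset.sum_filter, Finset.filter_mem_eq_inter, Finset.inter_eq_right.2 hB]
  unfold betaS
  congr 1
  · let g : Finset U → Finset U → ℝ := fun σ σ' =>
      (if σ ∈ A then if σ' ∈ A then
        if σ' ≠ σ ∧ sprodZ K k σ σ' = -1 then (1 : ℝ) else 0 else 0 else 0) +
      (if σ ∈ A' then if σ' ∈ A' then
        if σ' ≠ σ ∧ sprodZ K k σ σ' = -1 then (1 : ℝ) else 0 else 0 else 0) +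
      2 * (if σ ∈ A then if σ' ∈ A' then
        if σ' ≠ σ ∧ sprodZ K k σ σ' = 1 then (1 : ℝ) else 0 else 0 else 0) +
      (if σ ∈ A ∪ A' then if σ' ∈ faces K k \ (A ∪ A') then
        if σ' ≠ σ ∧ sprodZ K k σ σ' ≠ 0 then (1 : ℝ) else 0 else 0 else 0)
    have hpt : ∀ σ ∈ faces K k, ∀ σ' ∈ faces K k, |edgeSign K k σ σ'| *
        |signedIndicator A A' σ - edgeSign K k σ σ' * signedIndicator A A' σ'| =
        g σ σ' + g σ' σ := by
      intro σ hσ σ' hσ'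
      simp only [g, edgeSign, signedIndicator, sprodZ_comm K k σ' σ, Finset.mem_union,
        Finset.mem_sdiff, hσ, hσ']
      by_cases hne : σ = σ'
      · simp [hne]
      · have hd1 : σ ∈ A → σ ∉ A' := fun h => Finset.disjoint_left.1 hdisj h
        have hd2 : σ' ∈ A → σ' ∉ A' := fun h => Finset.disjoint_left.1 hdisj h
        have hne' : σ' ≠ σ := fun h => hne h.symm
        rcases (sprodZ_trichotomy K k (Finset.mem_filter.1 hσ).2
          (Finset.mem_filter.1 hσ').2 hne).1 with h | h | h <;>
        by_cases h1 : σ ∈ A <;> by_cases h2 : σ' ∈ A <;>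
        by_cases h3 : σ ∈ A' <;> by_cases h4 : σ' ∈ A' <;>
        first
        | exact absurd h3 (hd1 h1)
        | exact absurd h4 (hd2 h2)
        | (simp [h, h1, h2, h3, h4, hne, hne']; try norm_num)
    rw [Finset.sum_congr rfl fun σ hσ => Finset.sum_congr rfl (hpt σ hσ)]
    simp only [Finset.sum_add_distrib]
    rw [Finset.sum_comm (f := fun σ σ' => g σ' σ), add_self_div_two]
    have hpush : ∀ (B C : Finset (Finset U)), B ⊆ faces K k → C ⊆ faces K k →
        ∀ w : Finset U → Finset U → ℝ, ∑ σ ∈ B, ∑ σ' ∈ C, w σ σ' =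
        ∑ σ ∈ faces K k, ∑ σ' ∈ faces K k,
          if σ ∈ B then if σ' ∈ C then w σ σ' else 0 else 0 := by
      intro B C hB hC w
      rw [hsub B hB]
      refine Finset.sum_congr rfl fun σ _ => ?_
      rw [hsub C hC]
      split_ifs <;> simp
    rw [hpush A A hA hA, hpush A' A' hA' hA', hpush A A' hA hA',
      hpush (A ∪ A') (faces K k \ (A ∪ A')) hAA Finset.sdiff_subset]
    simp only [g, Finset.sum_add_distrib, Finset.mul_sum]
  · rw [hsub _ hAA]
    refine Finset.sum_congr rfl fun σ _ => ?_
    by_cases h1 : σ ∈ A <;> by_cases h2 : σ ∈ A' <;> simp [signedIndicator, h1, h2]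

theorem sum_degS_mul_abs_signedIndicator_pos {U : Type*} [LinearOrder U]
    (K : Finset (Finset U)) (k : ℕ) (hdeg : ∀ σ ∈ faces K k, 0 < degS K σ)
    {A A' : Finset (Finset U)} (hA : A ⊆ faces K k) (hA' : A' ⊆ faces K k)
    (hne : (A ∪ A').Nonempty) :
    0 < ∑ σ ∈ faces K k, (degS K σ : ℝ) * |signedIndicator A A' σ| := by
  obtain ⟨σ, hσ⟩ := hne
  have hF := Finset.union_subset hA hA' hσ
  refine Finset.sum_pos' (fun _ _ => by positivity) ⟨σ, hF, ?_⟩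
  have : (0 : ℝ) < degS K σ := by exact_mod_cast hdeg σ hF
  have h1 : |signedIndicator A A' σ| = 1 := by
    rcases Finset.mem_union.1 hσ with h | h
    · simp [signedIndicator, h]
    · by_cases h' : σ ∈ A <;> simp [signedIndicator, h, h']
  rw [h1, mul_one]
  exact this

theorem betaS_nonneg {U : Type*} [LinearOrder U] (K : Finset (Finset U)) (k : ℕ)
    {A A' : Finset (Finset U)} (hA : A ⊆ faces K k) (hA' : A' ⊆ faces K k)
    (hdisj : Disjoint A A') : 0 ≤ betaS K k A A' := by
  rw [betaS_eq K k hA hA' hdisj]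
  have h1 : 0 ≤ ∑ σ ∈ faces K k, (degS K σ : ℝ) * |signedIndicator A A' σ| :=
    Finset.sum_nonneg fun _ _ => by positivity
  have h2 : 0 ≤ ∑ σ ∈ faces K k, ∑ σ' ∈ faces K k, |edgeSign K k σ σ'| *
      |signedIndicator A A' σ - edgeSign K k σ σ' * signedIndicator A A' σ'| :=
    Finset.sum_nonneg fun _ _ => Finset.sum_nonneg fun _ _ => by positivity
  positivity

/-- Cheeger inequalities for the largest eigenvalue of `Δ_k^up`:
`h₁(Σ_k)²/(2(k+1)) ≤ k + 2 − λ_max(Δ_k^up) ≤ 2h₁(Σ_k)`. -/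
theorem stmt18 {U : Type*} [LinearOrder U] (K : Finset (Finset U))
    (hK : IsSimplicialComplex K) (k : ℕ)
    (hdeg : ∀ σ ∈ faces K k, 0 < degS K σ)
    (lamMax : ℝ)
    (hev : Module.End.HasEigenvalue (upLapMatrix K k).mulVecLin lamMax)
    (hmax : ∀ μ : ℝ, Module.End.HasEigenvalue (upLapMatrix K k).mulVecLin μ → μ ≤ lamMax) :
    h1S K k ^ 2 / (2 * ((k : ℝ) + 1)) ≤ (k : ℝ) + 2 - lamMax ∧
      (k : ℝ) + 2 - lamMax ≤ 2 * h1S K k := by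
  have hd : ∀ i : {σ // σ ∈ faces K k}, (0 : ℝ) < degS K i.1 := fun i => by
    exact_mod_cast hdeg i.1 i.2
  have hsymm : ∀ i j : {σ // σ ∈ faces K k}, edgeSign K k i.1 j.1 = edgeSign K k j.1 i.1 :=
    fun i j => edgeSign_comm K k _ _
  have hs : ∀ i j : {σ // σ ∈ faces K k},
      edgeSign K k i.1 j.1 = 0 ∨ edgeSign K k i.1 j.1 = 1 ∨ edgeSign K k i.1 j.1 = -1 :=
    fun i j => edgeSign_trichotomy K k i.2 j.2
  have hsum : ∀ i : {σ // σ ∈ faces K k},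
      ∑ j : {σ // σ ∈ faces K k}, |edgeSign K k i.1 j.1| = ((k : ℝ) + 1) * degS K i.1 :=
    fun i => by
      rw [Finset.sum_coe_sort (faces K k) fun σ' => |edgeSign K k i.1 σ'|]
      exact sum_abs_edgeSign K hK k i.2
  have hM : ∀ i j, upLapMatrix K k i j =
      (if i = j then 1 else 0) + (degS K i.1 : ℝ)⁻¹ * edgeSign K k i.1 j.1 := by
    intro i j
    by_cases h : i = j
    · simp [upLapMatrix, edgeSign, h]
    · have h' : i.1 ≠ j.1 := fun e => h (Subtype.ext e)
      simp [upLapMatrix, edgeSign, h, h', sprodZ]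
  have hform := half_sum_abs_mul_sub_sq _ _ _ hsymm hs hsum
  obtain ⟨f, hf⟩ := hev.exists_hasEigenvector
  have hbdd : BddBelow { r : ℝ | ∃ A A' : Finset (Finset U), A ⊆ faces K k ∧ A' ⊆ faces K k ∧
      Disjoint A A' ∧ (A ∪ A').Nonempty ∧ r = betaS K k A A' } := by
    refine ⟨0, ?_⟩
    rintro r ⟨A, A', hA, hA', hdisj, _, rfl⟩
    exact betaS_nonneg K k hA hA' hdisj
  have hfne : ∃ i, f i ≠ 0 := Function.ne_iff.1 hf.2
  constructor
  · have hcut := sq_mul_le_of_forall_signed_cut _ _ ((k : ℝ) + 1) (h1S K k) (by positivity)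
      (Real.sInf_nonneg (by
        rintro r ⟨A, A', hA, hA', hdisj, _, rfl⟩
        exact betaS_nonneg K k hA hA' hdisj)) hd hsymm hs hsum (by
        intro x hx
        let y : Finset U → ℝ := fun σ => if h : σ ∈ faces K k then x ⟨σ, h⟩ else 0
        let A := (faces K k).filter fun σ => y σ = 1
        let A' := (faces K k).filter fun σ => y σ = -1
        have hA : A ⊆ faces K k := Finset.filter_subset _ _
        have hA' : A' ⊆ faces K k := Finset.filter_subset _ _
        have hy : ∀ i : {σ // σ ∈ faces K k}, y i.1 = x i := fun i => by simp [y]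
        have hxi : ∀ i : {σ // σ ∈ faces K k}, x i = signedIndicator A A' i.1 := fun i => by
          simp only [signedIndicator, A, A', Finset.mem_filter, i.2, true_and, hy]
          rcases hx i with h | h | h <;> rw [h] <;> norm_num
        have hdisj : Disjoint A A' := by
          rw [Finset.disjoint_filter]
          intro σ _ h
          rw [h]; norm_num
        simp only [hxi]
        rw [Finset.sum_coe_sort (faces K k) fun σ => (degS K σ : ℝ) * |signedIndicator A A' σ|]
        have hc : ∀ i : {σ // σ ∈ faces K k}, ∑ j : {σ // σ ∈ faces K k},
            |edgeSign K k i.1 j.1| * |signedIndicator A A' i.1 -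
              edgeSign K k i.1 j.1 * signedIndicator A A' j.1| =
            ∑ σ' ∈ faces K k, |edgeSign K k i.1 σ'| * |signedIndicator A A' i.1 -
              edgeSign K k i.1 σ' * signedIndicator A A' σ'| := fun i =>
          Finset.sum_coe_sort (faces K k) fun σ' => |edgeSign K k i.1 σ'| *
            |signedIndicator A A' i.1 - edgeSign K k i.1 σ' * signedIndicator A A' σ'|
        simp only [hc]
        rw [Finset.sum_coe_sort (faces K k) fun σ => ∑ σ' ∈ faces K k, |edgeSign K k σ σ'| *
            |signedIndicator A A' σ - edgeSign K k σ σ' * signedIndicator A A' σ'|]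
        by_cases hne : (A ∪ A').Nonempty
        · rw [← le_div_iff₀ (sum_degS_mul_abs_signedIndicator_pos K k hdeg hA hA' hne),
            ← betaS_eq K k hA hA' hdisj]
          exact csInf_le hbdd ⟨A, A', hA, hA', hdisj, hne, rfl⟩
        · have h0 : ∀ σ, signedIndicator A A' σ = 0 := by
            intro σ
            rw [Finset.not_nonempty_iff_eq_empty, Finset.union_eq_empty] at hne
            simp [signedIndicator, hne.1, hne.2]
          simp [h0]) f
    have heig : ∀ i, (degS K i.1 : ℝ) * f i ^ 2 + ∑ j, edgeSign K k i.1 j.1 * f i * f j =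
        lamMax * ((degS K i.1 : ℝ) * f i ^ 2) := by
      intro i
      have h1 := congrFun (Module.End.mem_eigenspace_iff.1 hf.1) i
      simp only [Matrix.mulVecLin_apply, Matrix.mulVec, dotProduct, hM, add_mul,
        Finset.sum_add_distrib, ite_mul, zero_mul, one_mul, Finset.sum_ite_eq,
        Finset.mem_univ, if_true, Pi.smul_apply, smul_eq_mul, mul_assoc, ← Finset.mul_sum] at h1
      have h2 : ∑ j, edgeSign K k i.1 j.1 * f i * f j =
          f i * ∑ j, edgeSign K k i.1 j.1 * f j := by
        rw [Finset.mul_sum]; exact Finset.sum_congr rfl fun j _ => by ring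
      rw [h2]
      have h3 : (degS K i.1 : ℝ) ≠ 0 := (hd i).ne'
      field_simp at h1
      linear_combination f i * h1
    have hE := Finset.sum_congr (rfl : (Finset.univ : Finset {σ // σ ∈ faces K k}) = _)
      fun i _ => heig i
    rw [Finset.sum_add_distrib, ← Finset.mul_sum] at hE
    rw [hform f] at hcut
    have hpos : 0 < ∑ i : {σ // σ ∈ faces K k}, (degS K i.1 : ℝ) * f i ^ 2 := by
      obtain ⟨i, hi⟩ := hfne
      refine Finset.sum_pos' (fun j _ => by positivity) ⟨i, Finset.mem_univ _, ?_⟩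
      have := hd i
      positivity
    rw [div_le_iff₀ (by positivity)]
    refine le_of_mul_le_mul_right ?_ hpos
    linear_combination hcut - 2 * ((k : ℝ) + 1) * hE
  · suffices h : ((k : ℝ) + 2 - lamMax) / 2 ≤ h1S K k by linarith
    refine le_csInf ?_ ?_
    · obtain ⟨i, _⟩ := hfne
      exact ⟨_, {i.1}, ∅, by simp, by simp, by simp, by simp, rfl⟩
    rintro r ⟨A, A', hA, hA', hdisj, hne, rfl⟩
    rw [betaS_eq K k hA hA' hdisj,
      le_div_iff₀ (sum_degS_mul_abs_signedIndicator_pos K k hdeg hA hA' hne)]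
    have hR := rayleigh_le_of_forall_hasEigenvalue_le _ _ hd hsymm
      _ hM lamMax hmax fun i => signedIndicator A A' i.1
    have hF := hform fun i => signedIndicator A A' i.1
    have hval : ∀ σ, signedIndicator A A' σ = 0 ∨ signedIndicator A A' σ = 1 ∨
        signedIndicator A A' σ = -1 := by
      intro σ
      unfold signedIndicator
      split_ifs <;> simp
    have hsq : ∀ σ, signedIndicator A A' σ ^ 2 = |signedIndicator A A' σ| := by
      intro σ
      rcases hval σ with h | h | h <;> rw [h] <;> norm_num
    simp only [hsq] at hR hF
    rw [← Finset.sum_coe_sort (faces K k) fun σ => (degS K σ : ℝ) * |signedIndicator A A' σ|]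
    have hle : ∑ i : {σ // σ ∈ faces K k}, ∑ j : {σ // σ ∈ faces K k},
        |edgeSign K k i.1 j.1| * (signedIndicator A A' i.1 -
          edgeSign K k i.1 j.1 * signedIndicator A A' j.1) ^ 2 ≤
        2 * ∑ σ ∈ faces K k, ∑ σ' ∈ faces K k, |edgeSign K k σ σ'| *
          |signedIndicator A A' σ - edgeSign K k σ σ' * signedIndicator A A' σ'| := by
      rw [← Finset.sum_coe_sort (faces K k), Finset.mul_sum]
      refine Finset.sum_le_sum fun i _ => ?_
      rw [← Finset.sum_coe_sort (faces K k), Finset.mul_sum]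
      refine Finset.sum_le_sum fun j _ => ?_
      rcases hs i j with h | h | h <;> rcases hval i.1 with h1 | h1 | h1 <;>
      rcases hval j.1 with h2 | h2 | h2 <;> rw [h, h1, h2] <;> norm_num
    linarith
end
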